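/- Let x, a, b, c, d ≥ 1 be integers such that a² + a + 1, b² + b + 1, c² + c + 1 and d² + d + 1 are all prime, x² + x + 1 = (a² + a + 1)(b² + b + 1)(c² + c + 1)(d² + d + 1), at least one of a, b, c, d equals 1, and all of a, b, c, d are odd. Then the multiset {a, b, c, d} equals {1, 3, 3, 21} and x = 484; in particular x is even. -/

import Mathlib

/-- If a prime `d² + d + 1` divides the norm of the Eisenstein integer `u + vω`, then `d - ω` or
its conjugate `d + 1 + ω` divides `u + vω`. -/
theorem exists_eisenstein_quotient {d : ℕ} (hp : Nat.Prime (d ^ 2 + d + 1)) {u v m : ℤ}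
    (h : u ^ 2 - u * v + v ^ 2 = ((d : ℤ) ^ 2 + d + 1) * m) :
    ∃ s t : ℤ, s ^ 2 - s * t + t ^ 2 = m ∧
      ((u = s * d + t ∧ v = t * (d + 1) - s) ∨ (u = s * (d + 1) - t ∧ v = s + t * d)) := by
  have hp' : Prime ((d : ℤ) ^ 2 + d + 1) := by
    have := Nat.prime_iff_prime_int.mp hp
    push_cast at this
    exact this
  have hdvd : ((d : ℤ) ^ 2 + d + 1) ∣ (u + d * v) * (u - (d + 1) * v) :=
    ⟨m - v ^ 2, by linear_combination h⟩
  rcases hp'.dvd_or_dvd hdvd with ⟨t, ht⟩ | ⟨t, ht⟩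
  · have hu : u = (t * (d + 1) - v) * d + t := by linear_combination ht
    refine ⟨t * (d + 1) - v, t, mul_left_cancel₀ hp'.ne_zero ?_, Or.inl ⟨hu, by ring⟩⟩
    rw [← h, hu]
    ring
  · have hu : u = (v + t * d) * (d + 1) + t := by linear_combination ht
    refine ⟨v + t * d, -t, mul_left_cancel₀ hp'.ne_zero ?_, Or.inr ⟨by rw [hu]; ring, by ring⟩⟩
    rw [← h, hu]
    ring

/-- The six units of the Eisenstein integers. -/
theorem eisenstein_units {s t : ℤ} (h : s ^ 2 - s * t + t ^ 2 = 1) :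
    (s = 1 ∧ t = 0) ∨ (s = -1 ∧ t = 0) ∨ (s = 0 ∧ t = 1) ∨ (s = 0 ∧ t = -1) ∨
      (s = 1 ∧ t = 1) ∨ (s = -1 ∧ t = -1) := by
  have h1 : s ≤ 1 := by nlinarith [sq_nonneg (s - 2 * t)]
  have h2 : -1 ≤ s := by nlinarith [sq_nonneg (s - 2 * t)]
  have h3 : t ≤ 1 := by nlinarith [sq_nonneg (2 * s - t)]
  have h4 : -1 ≤ t := by nlinarith [sq_nonneg (2 * s - t)]
  interval_cases s <;> interval_cases t <;> simp_all

theorem eq_of_sorted_of_mul_eq {b c d : ℕ} (hb : 3 ≤ b) (hbc : b ≤ c) (hcd : c ≤ d) (hob : Odd b)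
    (hpd : Nat.Prime (d ^ 2 + d + 1))
    (h : b * c * d = 2 * (b + c + d) + (b * c + b * d + c * d) ∨
      b * c * d = 2 * (b + c + d) + (b * c + b * d + c * d) + 2) :
    ({b, c, d} : Multiset ℕ) = {3, 3, 21} := by
  have hb3 : b = 3 := by
    by_contra hne
    have hb5 : 5 ≤ b := by
      obtain ⟨k, rfl⟩ := hob
      omega
    have h1 : b * c * d ≥ 5 * (c * d) := by
      rw [mul_assoc]
      gcongr
    have h2 : b * c ≤ c * d := by nlinarith
    have h3 : b * d ≤ c * d := by gcongr
    have h4 : 5 * d ≤ c * d := by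
      gcongr
      omega
    omega
  subst hb3
  have hc : c ≤ 5 := by
    by_contra hlt
    push Not at hlt
    rcases h with h | h <;> nlinarith
  interval_cases c
  · have hd : d = 21 ∨ d = 23 := by omega
    rcases hd with rfl | rfl
    · rfl
    · norm_num at hpd
  · omega
  · omega

theorem eq_of_mul_eq {b c d : ℕ} (hb : 3 ≤ b) (hc : 3 ≤ c) (hd : 3 ≤ d)
    (hob : Odd b) (hoc : Odd c) (hod : Odd d) (hpb : Nat.Prime (b ^ 2 + b + 1))
    (hpc : Nat.Prime (c ^ 2 + c + 1)) (hpd : Nat.Prime (d ^ 2 + d + 1))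
    (h : b * c * d = 2 * (b + c + d) + (b * c + b * d + c * d) ∨
      b * c * d = 2 * (b + c + d) + (b * c + b * d + c * d) + 2) :
    ({b, c, d} : Multiset ℕ) = {3, 3, 21} := by
  rcases le_total b c with h1 | h1 <;> rcases le_total c d with h2 | h2 <;>
    rcases le_total b d with h3 | h3
  · exact eq_of_sorted_of_mul_eq hb h1 h2 hob hpd h
  · exact eq_of_sorted_of_mul_eq hb h1 h2 hob hpd h
  · rw [← eq_of_sorted_of_mul_eq hb h3 h2 hob hpc (by convert h using 2 <;> ring)]
    simp only [Multiset.insert_eq_cons, ← Multiset.singleton_add]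
    abel
  · rw [← eq_of_sorted_of_mul_eq hd h3 h1 hod hpc (by convert h using 2 <;> ring)]
    simp only [Multiset.insert_eq_cons, ← Multiset.singleton_add]
    abel
  · rw [← eq_of_sorted_of_mul_eq hc h1 h3 hoc hpd (by convert h using 2 <;> ring)]
    simp only [Multiset.insert_eq_cons, ← Multiset.singleton_add]
    abel
  · rw [← eq_of_sorted_of_mul_eq hc h2 h3 hoc hpb (by convert h using 2 <;> ring)]
    simp only [Multiset.insert_eq_cons, ← Multiset.singleton_add]
    abel
  · rw [← eq_of_sorted_of_mul_eq hd h2 h1 hod hpb (by convert h using 2 <;> ring)]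
    simp only [Multiset.insert_eq_cons, ← Multiset.singleton_add]
    abel
  · rw [← eq_of_sorted_of_mul_eq hd h2 h1 hod hpb (by convert h using 2 <;> ring)]
    simp only [Multiset.insert_eq_cons, ← Multiset.singleton_add]
    abel

/-- Up to sign, the three coordinate forms of `(1 - ω)(b - ω)(c - ω)(d - ω)` take the value `1`
only when `bcd - 2(b + c + d) - (bc + bd + cd)` is `0` or `2`. -/
theorem mul_eq_of_unconjugated {b c d : ℕ} (hb : 3 ≤ b) (hc : 3 ≤ c) (hd : 3 ≤ d)
    (h : ((b : ℤ) * c * d - 1 - 2 * (b + c + d) - (b * c + b * d + c * d)) ^ 2 = 1 ∨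
      ((b : ℤ) * c * d - 1 + (b + c + d) + 2 * (b * c + b * d + c * d)) ^ 2 = 1 ∨
      (2 * ((b : ℤ) * c * d) - 2 - (b + c + d) + (b * c + b * d + c * d)) ^ 2 = 1) :
    b * c * d = 2 * (b + c + d) + (b * c + b * d + c * d) ∨
      b * c * d = 2 * (b + c + d) + (b * c + b * d + c * d) + 2 := by
  have h1 : 3 * b ≤ b * c := by nlinarith
  have h2 : 3 * d ≤ b * d := by gcongr
  have h3 : 3 * c ≤ c * d := by nlinarith
  zify at *
  have h4 : (0 : ℤ) ≤ b * c * d := by positivity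
  have h5 : (b : ℤ) * c ≤ b * c * d := by nlinarith
  generalize (b : ℤ) * c * d = p at *
  rcases h with h | h | h <;> rcases sq_eq_one_iff.mp h with h | h <;> omega

theorem not_coordinate_of_conjugated {b c d : ℕ} (hb : 3 ≤ b) (hc : 3 ≤ c) (hd : 3 ≤ d)
    (hob : Odd b) (hoc : Odd c) (hod : Odd d) :
    ¬ ((((b : ℤ) * c - 1) * (d + 2) + (b + c + 1) * (1 - d)) ^ 2 = 1 ∨
      (((b : ℤ) * c - 1) * (1 - d) - (b + c + 1) * (2 * d + 1)) ^ 2 = 1 ∨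
      (((b : ℤ) * c - 1) * (2 * d + 1) + (b + c + 1) * (d + 2)) ^ 2 = 1) := by
  have h1 : 9 ≤ b * c := by nlinarith
  zify at hb hc hd h1
  rintro (h | h | h)
  · have heven : Even (((b : ℤ) * c - 1) * (d + 2) + (b + c + 1) * (1 - d)) := by
      have hb' : Odd (b : ℤ) := by exact_mod_cast hob
      have hc' : Odd (c : ℤ) := by exact_mod_cast hoc
      have hd' : Odd (d : ℤ) := by exact_mod_cast hod
      exact (((hb'.mul hc').sub_odd odd_one).mul_right _).add ((odd_one.sub_odd hd').mul_left _)
    have := heven.pow_of_ne_zero two_ne_zero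
    rw [h] at this
    exact absurd this (by decide)
  · rcases sq_eq_one_iff.mp h with h | h <;>
      nlinarith [mul_nonneg (sub_nonneg.2 h1) (sub_nonneg.2 hd)]
  · rcases sq_eq_one_iff.mp h with h | h <;>
      nlinarith [mul_nonneg (sub_nonneg.2 h1) (sub_nonneg.2 hd)]

theorem not_nine_dvd_sq_add_self_add_one (x : ℕ) : ¬ 9 ∣ x ^ 2 + x + 1 := by
  intro h
  have h' : (x ^ 2 + x + 1) % 9 = 0 := Nat.mod_eq_zero_of_dvd h
  have hx : x % 9 < 9 := Nat.mod_lt _ (by norm_num)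
  rw [Nat.add_mod, Nat.add_mod (x ^ 2), Nat.pow_mod] at h'
  interval_cases x % 9 <;> simp at h'

set_option maxHeartbeats 1600000 in
theorem three_factors_times_three {x b c d : ℕ}
    (hpb : Nat.Prime (b ^ 2 + b + 1)) (hpc : Nat.Prime (c ^ 2 + c + 1))
    (hpd : Nat.Prime (d ^ 2 + d + 1))
    (heq : x ^ 2 + x + 1 = 3 * (b ^ 2 + b + 1) * (c ^ 2 + c + 1) * (d ^ 2 + d + 1))
    (hob : Odd b) (hoc : Odd c) (hod : Odd d) :
    ({b, c, d} : Multiset ℕ) = {3, 3, 21} ∧ x = 484 := by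
  have three_le : ∀ {e m : ℕ}, Odd e → x ^ 2 + x + 1 = 3 * (e ^ 2 + e + 1) * m → 3 ≤ e := by
    intro e m ho he
    obtain ⟨k, rfl⟩ := ho
    rcases Nat.eq_zero_or_pos k with rfl | hk
    · exact absurd ⟨m, by rw [he]; ring⟩ (not_nine_dvd_sq_add_self_add_one x)
    · omega
  have hb : 3 ≤ b := three_le (m := (c ^ 2 + c + 1) * (d ^ 2 + d + 1)) hob (by rw [heq]; ring)
  have hc : 3 ≤ c := three_le (m := (b ^ 2 + b + 1) * (d ^ 2 + d + 1)) hoc (by rw [heq]; ring)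
  have hd : 3 ≤ d := three_le (m := (b ^ 2 + b + 1) * (c ^ 2 + c + 1)) hod (by rw [heq]; ring)
  have hset : ({b, c, d} : Multiset ℕ) = {3, 3, 21} := by
    have hp3 : Nat.Prime (1 ^ 2 + 1 + 1) := by norm_num
    have hnorm : (x : ℤ) ^ 2 - x * (-1) + (-1) ^ 2 = (((1 : ℕ) : ℤ) ^ 2 + (1 : ℕ) + 1) *
        (((d : ℤ) ^ 2 + d + 1) * (((c : ℤ) ^ 2 + c + 1) * (((b : ℤ) ^ 2 + b + 1) * 1))) := by
      zify at heq
      push_cast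
      linear_combination heq
    obtain ⟨u₁, v₁, h₁, hx⟩ := exists_eisenstein_quotient hp3 hnorm
    obtain ⟨u₂, v₂, h₂, hd'⟩ := exists_eisenstein_quotient hpd h₁
    obtain ⟨u₃, v₃, h₃, hc'⟩ := exists_eisenstein_quotient hpc h₂
    obtain ⟨s, t, h₄, hb'⟩ := exists_eisenstein_quotient hpb h₃
    have key : v₁ * 2 - u₁ = -1 ∨ u₁ + v₁ = -1 := by
      push_cast at hx
      rcases hx with ⟨-, h⟩ | ⟨-, h⟩
      · left; linarith
      · right; linarith
    clear h₁ h₂ h₃ hx hnorm heq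
    apply eq_of_mul_eq hb hc hd hob hoc hod hpb hpc hpd
    have hS := mul_eq_of_unconjugated hb hc hd
    have hD := not_coordinate_of_conjugated hb hc hd hob hoc hod
    have hC := not_coordinate_of_conjugated hb hd hc hob hod hoc
    have hB := not_coordinate_of_conjugated hc hd hb hoc hod hob
    clear three_le hpb hpc hpd hp3 hob hoc hod hb hc hd
    have hunits := eisenstein_units h₄
    clear h₄
    rcases hb' with ⟨rfl, rfl⟩ | ⟨rfl, rfl⟩ <;> rcases hc' with ⟨rfl, rfl⟩ | ⟨rfl, rfl⟩ <;>
      rcases hd' with ⟨rfl, rfl⟩ | ⟨rfl, rfl⟩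
    on_goal 1 => apply hS
    on_goal 2 => apply (hD ?_).elim
    on_goal 3 => apply (hC ?_).elim
    on_goal 4 => apply (hB ?_).elim
    on_goal 5 => apply (hB ?_).elim
    on_goal 6 => apply (hC ?_).elim
    on_goal 7 => apply (hD ?_).elim
    on_goal 8 => apply hS
    all_goals
      clear hS hD hC hB
      rcases hunits with ⟨rfl, rfl⟩ | ⟨rfl, rfl⟩ | ⟨rfl, rfl⟩ | ⟨rfl, rfl⟩ | ⟨rfl, rfl⟩ |
          ⟨rfl, rfl⟩ <;>
        rcases key with key | key <;>
        simp only [sq_eq_one_iff] <;>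
        first
        | exact Or.inl (Or.inl (by linear_combination -key))
        | exact Or.inl (Or.inr (by linear_combination key))
        | exact Or.inr (Or.inl (Or.inl (by linear_combination -key)))
        | exact Or.inr (Or.inl (Or.inr (by linear_combination key)))
        | exact Or.inr (Or.inr (Or.inl (by linear_combination -key)))
        | exact Or.inr (Or.inr (Or.inr (by linear_combination key)))
  refine ⟨hset, ?_⟩
  have hprod := congrArg (fun s : Multiset ℕ => (s.map fun e => e ^ 2 + e + 1).prod) hset
  simp only [Multiset.insert_eq_cons, Multiset.map_cons, Multiset.map_singleton,
    Multiset.prod_cons, Multiset.prod_singleton] at hprod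
  have hx : x ^ 2 + x + 1 = 234741 := by
    rw [heq, mul_assoc, mul_assoc, hprod]
    norm_num
  nlinarith


/-- If `x² + x + 1 = Φ₃(a)Φ₃(b)Φ₃(c)Φ₃(d)` with all four factors prime, one entry equal
to `1`, and all of `a, b, c, d` odd, then `{a, b, c, d} = {1, 3, 3, 21}` and `x = 484`;
in particular `x` is even. -/
theorem four_factors_with_one_odd (x a b c d : ℕ) (hx : 1 ≤ x) (ha : 1 ≤ a) (hb : 1 ≤ b)
    (hc : 1 ≤ c) (hd : 1 ≤ d)
    (hpa : Nat.Prime (a ^ 2 + a + 1)) (hpb : Nat.Prime (b ^ 2 + b + 1))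
    (hpc : Nat.Prime (c ^ 2 + c + 1)) (hpd : Nat.Prime (d ^ 2 + d + 1))
    (heq : x ^ 2 + x + 1 =
      (a ^ 2 + a + 1) * (b ^ 2 + b + 1) * (c ^ 2 + c + 1) * (d ^ 2 + d + 1))
    (hone : a = 1 ∨ b = 1 ∨ c = 1 ∨ d = 1)
    (hoa : Odd a) (hob : Odd b) (hoc : Odd c) (hod : Odd d) :
    ({a, b, c, d} : Multiset ℕ) = ({1, 3, 3, 21} : Multiset ℕ) ∧ x = 484 ∧ Even x := by
  have even_484 : Even 484 := by decide
  rcases hone with rfl | rfl | rfl | rfl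
  · obtain ⟨h, rfl⟩ := three_factors_times_three hpb hpc hpd heq hob hoc hod
    exact ⟨by rw [h], rfl, even_484⟩
  · obtain ⟨h, rfl⟩ := three_factors_times_three hpa hpc hpd (by rw [heq]; ring) hoa hoc hod
    refine ⟨?_, rfl, even_484⟩
    rw [← h]
    exact Multiset.cons_swap _ _ _
  · obtain ⟨h, rfl⟩ := three_factors_times_three hpa hpb hpd (by rw [heq]; ring) hoa hob hod
    refine ⟨?_, rfl, even_484⟩
    rw [← h]
    simp only [Multiset.insert_eq_cons, ← Multiset.singleton_add]
    abel
  · obtain ⟨h, rfl⟩ := three_factors_times_three hpa hpb hpc (by rw [heq]; ring) hoa hob hoc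
    refine ⟨?_, rfl, even_484⟩
    rw [← h]
    simp only [Multiset.insert_eq_cons, ← Multiset.singleton_add]
    abel
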